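/- arXiv:dg-ga/9706012 — 2 statements merged into one kernel-verified Lean document; each statement's English description precedes it below -/
import Mathlib

section
/- Let F be a field and let (C_*, ∂) be a finite chain complex of finite-dimensional F-vector spaces equipped with an ordered basis e (an ordered basis e_i of each C_i). If the complex is acyclic (H_*(C) = 0), then there exists a decomposition C_i = A_i ⊕ B_i for every i such that (i) A_i and B_i are each spanned by a subset of the basis e_i, and (ii) the composition π_{B_{i-1}} ∘ ∂|_{A_i} : A_i → B_{i-1} of the restriction of ∂ with the projection onto B_{i-1} is an isomorphism for every i. -/
open Module Submodule

noncomputable section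

variable (F : Type) [Field F]

section ChainComplex

variable (C : ℕ → Type) [∀ i, AddCommGroup (C i)] [∀ i, Module F (C i)]
  (d : ∀ i, C (i + 1) →ₗ[F] C i)

/-- The cycles `Z_i` of the chain complex `(C_*, ∂)`; by convention `Z_0 = C_0` since there is
no differential out of degree `0`. -/
def cyc : ∀ i : ℕ, Submodule F (C i)
  | 0 => ⊤
  | (i + 1) => LinearMap.ker (d i)

/-- The boundaries `B_i = im ∂_{i+1}` of the chain complex `(C_*, ∂)`. -/
def bdry (i : ℕ) : Submodule F (C i) := LinearMap.range (d i)

end ChainComplex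

/-- Every submodule has a complement spanned by a subset of a given basis. -/
theorem Module.Basis.exists_isCompl_span_image {K V κ : Type*} [Field K] [AddCommGroup V]
    [Module K V] (b : Basis κ K V) (Z : Submodule K V) :
    ∃ s : Set κ, IsCompl (span K (b '' s)) Z := by
  obtain ⟨s, -, -, hspan, hs⟩ := exists_linearIndepOn_extension
    (linearIndepOn_empty K (Z.mkQ ∘ b)) (Set.empty_subset Set.univ)
  refine ⟨s, ?_, ?_⟩
  · have h : Disjoint (span K (Set.range fun i : s => b i)) (LinearMap.ker Z.mkQ) :=
      Submodule.range_ker_disjoint hs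
    rwa [ker_mkQ, ← Set.image_eq_range] at h
  · rw [codisjoint_iff, eq_top_iff, ← b.span_eq, span_le]
    rintro _ ⟨i, rfl⟩
    have h := hspan ⟨i, Set.mem_univ i, rfl⟩
    rw [Set.image_comp, span_image] at h
    obtain ⟨x, hx, hxi⟩ := h
    have hz : b i - x ∈ Z := by
      rw [← Submodule.Quotient.mk_eq_zero, Submodule.Quotient.mk_sub, sub_eq_zero]
      exact hxi.symm
    exact mem_sup.2 ⟨x, hx, _, hz, add_sub_cancel x (b i)⟩

/-- If `A` is a complement of `ker f`, and `A'` is a common complement of `range f` and `B`, then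
`f` followed by the projection onto `B` along `A'` restricts to a bijection from `A` to `B`. -/
theorem Submodule.bijective_projectionOnto_comp_domRestrict {K V W : Type*} [Field K]
    [AddCommGroup V] [Module K V] [AddCommGroup W] [Module K W] (f : V →ₗ[K] W)
    {A : Submodule K V} {A' B : Submodule K W} (hA : IsCompl A (LinearMap.ker f))
    (hA' : IsCompl A' (LinearMap.range f)) (hB : IsCompl B A') :
    Function.Bijective ((B.projectionOnto A' hB).comp (f.comp A.subtype)) := by
  constructor
  · rw [← LinearMap.ker_eq_bot, LinearMap.ker_eq_bot']
    rintro ⟨x, hx⟩ h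
    have hfx : f x ∈ A' := (projectionOnto_apply_eq_zero_iff hB).1 h
    have hfx0 : f x = 0 := disjoint_def.1 hA'.disjoint _ hfx ⟨x, rfl⟩
    exact Subtype.ext (disjoint_def.1 hA.disjoint x hx hfx0)
  · intro y
    obtain ⟨a, ha, _, ⟨w, rfl⟩, hy⟩ :=
      mem_sup.1 (hA'.sup_eq_top ▸ mem_top : (y : W) ∈ A' ⊔ LinearMap.range f)
    obtain ⟨v, hv, k, hk, rfl⟩ := mem_sup.1 (hA.sup_eq_top ▸ mem_top : w ∈ A ⊔ LinearMap.ker f)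
    refine ⟨⟨v, hv⟩, ?_⟩
    have hfv : f v = y - a := by
      rw [← hy, map_add, LinearMap.mem_ker.1 hk]
      abel
    change B.projectionOnto A' hB (f v) = y
    rw [hfv, map_sub, projectionOnto_apply_left, (projectionOnto_apply_eq_zero_iff hB).2 ha,
      sub_zero]

/-- Let `F` be a field and `(C_*, ∂)` a finite chain complex of finite-dimensional
`F`-vector spaces, concentrated in degrees `0, …, n`, with an ordered basis `e_i` of each `C_i`.
If the complex is acyclic, then there are decompositions `C_i = A_i ⊕ B_i` where
`A_i = span(e_i(S_i))` and `B_i = span(e_i(T_i))` are spanned by subsets of the basis, such that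
the composition `π_{B_{i-1}} ∘ ∂|_{A_i} : A_i → B_{i-1}` of the restriction of `∂` to `A_i` with
the projection of `C_{i-1}` onto `B_{i-1}` (along `A_{i-1}`) is an isomorphism for every `i`
(for `i = 0` this means `A_0 ≅ B_{-1} = 0`, i.e. `A_0 = 0`). -/
theorem exists_subbasis_decomposition_of_acyclic
    (C : ℕ → Type) [∀ i, AddCommGroup (C i)] [∀ i, Module F (C i)]
    [∀ i, FiniteDimensional F (C i)]
    (d : ∀ i, C (i + 1) →ₗ[F] C i)
    (hd : ∀ i, (d i).comp (d (i + 1)) = 0)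
    (n : ℕ) (htriv : ∀ i, n < i → Subsingleton (C i))
    (ι : ℕ → Type) [∀ i, Fintype (ι i)] (e : ∀ i, Basis (ι i) F (C i))
    (hacyc : ∀ i, bdry F C d i = cyc F C d i) :
    ∃ S T : ∀ i, Finset (ι i),
      ∃ hcompl : ∀ i, IsCompl (span F (⇑(e i) '' ↑(S i))) (span F (⇑(e i) '' ↑(T i))),
        span F (⇑(e 0) '' ↑(S 0)) = ⊥ ∧
        ∀ i, Function.Bijective
          ((Submodule.linearProjOfIsCompl (span F (⇑(e i) '' ↑(T i)))
              (span F (⇑(e i) '' ↑(S i))) (hcompl i).symm).comp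
            ((d i).comp (span F (⇑(e (i + 1)) '' ↑(S (i + 1)))).subtype)) := by
  classical
  choose s hs using fun i => (e i).exists_isCompl_span_image (cyc F C d i)
  have hcompl : ∀ i, IsCompl (span F (⇑(e i) '' ↑(s i).toFinset))
      (span F (⇑(e i) '' ↑(s i).toFinsetᶜ)) := fun i => by
    rw [Finset.coe_compl]
    exact (e i).linearIndependent.isCompl_span_image (e i).span_eq isCompl_compl
  refine ⟨fun i => (s i).toFinset, fun i => (s i).toFinsetᶜ, hcompl, ?_, fun i => ?_⟩
  · rw [Set.coe_toFinset]
    exact disjoint_top.1 (hs 0).disjoint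
  · refine bijective_projectionOnto_comp_domRestrict (d i) ?_ ?_ (hcompl i).symm
    · rw [Set.coe_toFinset]
      exact hs (i + 1)
    · rw [Set.coe_toFinset]
      change IsCompl _ (bdry F C d i)
      rw [hacyc i]
      exact hs i

end
end

section
/- Let F be a field and let (C_*, ∂) be a finite acyclic chain complex of finite-dimensional F-vector spaces with ordered basis e. Suppose C_i = A_i ⊕ B_i is a decomposition such that A_i and B_i are spanned by subsets of the basis e_i and the map ∂ : A_i → B_{i-1} (meaning π_{B_{i-1}} ∘ ∂|_{A_i}) is an isomorphism for each i. Then the Reidemeister torsion satisfies τ(C_*, e) = ± ∏_i det(∂ : A_i → B_{i-1})^{(-1)^i}, where each determinant is computed with respect to the chosen subbases of A_i and B_{i-1}. -/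
open Module Submodule

noncomputable section

variable (F : Type) [Field F]

/-- The determinant of a finite family of vectors with respect to a basis, computed after an
arbitrary identification of the index types (this only affects the result up to sign). -/
def detFam {M ι κ : Type} [AddCommGroup M] [Module F M] [Fintype ι] [Fintype κ]
    (e : Basis ι F M) (v : κ → M) : F :=
  letI := Classical.propDecidable
  if hc : Nonempty (κ ≃ ι) then
    letI := Classical.decEq ι
    Basis.det e (v ∘ (Classical.choice hc).symm)
  else 0

/-- The determinant of a linear map with respect to bases of its domain and codomain. -/
def detMap {M N ι κ : Type} [AddCommGroup M] [Module F M] [AddCommGroup N] [Module F N]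
    [Fintype κ] [Fintype ι] (bM : Basis κ F M) (bN : Basis ι F N) (f : M →ₗ[F] N) : F :=
  detFam F bN fun j => f (bM j)

/-- The basis of the span of a subset of a basis, given by the corresponding basis vectors. -/
def subBasis {M ι : Type} [AddCommGroup M] [Module F M] (e : Basis ι F M) (S : Finset ι) :
    Basis {j // j ∈ S} F ↥(span F (⇑e '' ↑S)) :=
  (Basis.span ((e.linearIndependent).comp (fun j : {j // j ∈ S} => (j : ι))
    Subtype.val_injective)).map
    (LinearEquiv.ofEq _ _ (by rw [Set.range_comp]; congr 1; ext x; simp))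

section Torsion

variable (C : ℕ → Type) [∀ i, AddCommGroup (C i)] [∀ i, Module F (C i)]
  [∀ i, FiniteDimensional F (C i)] (d : ∀ i, C (i + 1) →ₗ[F] C i)

/-- The homology `H_i = Z_i / B_i` of the chain complex `(C_*, ∂)`. -/
abbrev hml (i : ℕ) : Type :=
  ↥(cyc F C d i) ⧸ Submodule.comap (cyc F C d i).subtype (bdry F C d i)

/-- A chosen linear right inverse of `∂ : C_{i+1} → B_i`. -/
def secB (i : ℕ) : ↥(bdry F C d i) →ₗ[F] C (i + 1) :=
  ((d i).rangeRestrict.exists_rightInverse_of_surjective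
    (LinearMap.range_eq_top.mpr (d i).surjective_rangeRestrict)).choose

/-- A chosen linear right inverse of the projection `Z_i → H_i`. -/
def secH (i : ℕ) : hml F C d i →ₗ[F] ↥(cyc F C d i) :=
  ((Submodule.comap (cyc F C d i).subtype (bdry F C d i)).mkQ.exists_rightInverse_of_surjective
    (Submodule.range_mkQ _)).choose

/-- The dimension of `B_{i-1}` (zero for `i = 0`). -/
def prevRank : ℕ → ℕ
  | 0 => 0
  | (i + 1) => finrank F ↥(bdry F C d i)

/-- A chosen lift to `C_i` of a basis of `B_{i-1}` (empty for `i = 0`). -/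
def thirdFam : ∀ i : ℕ, Fin (prevRank F C d i) → C i
  | 0 => fun j => j.elim0
  | (i + 1) => fun j => secB F C d i (Module.finBasis F ↥(bdry F C d i) j)

/-- The family of vectors in `C_i` consisting of a basis of `B_i`, a lift of the given basis of
`H_i`, and a lift of a basis of `B_{i-1}`.  This is a new basis of `C_i`; comparing it with the
given basis `e_i` computes the Reidemeister torsion à la Milnor. -/
def torFam {κ : ℕ → Type} (h : ∀ i, Basis (κ i) F (hml F C d i)) (i : ℕ) :
    Fin (finrank F ↥(bdry F C d i)) ⊕ κ i ⊕ Fin (prevRank F C d i) → C i :=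
  fun x => match x with
  | Sum.inl j => ((Module.finBasis F ↥(bdry F C d i) j : ↥(bdry F C d i)) : C i)
  | Sum.inr (Sum.inl k) => ((secH F C d i (h i k) : ↥(cyc F C d i)) : C i)
  | Sum.inr (Sum.inr j) => thirdFam F C d i j

/-- The Reidemeister torsion `τ̂(C_*, e, h) = Φ([e])/[h]` of the chain complex `(C_*, ∂)`
concentrated in degrees `0, …, n`, with respect to the basis `e` of `C_*` and the basis `h` of
the homology `H_*`, computed à la Milnor from a choice of auxiliary bases and sections (the
result is independent of these choices up to sign). -/
def torsionHat (n : ℕ) {ι κ : ℕ → Type} [∀ i, Fintype (ι i)] [∀ i, Fintype (κ i)]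
    (e : ∀ i, Basis (ι i) F (C i)) (h : ∀ i, Basis (κ i) F (hml F C d i)) : F :=
  ∏ i ∈ Finset.range (n + 1),
    (detFam F (e i) (torFam F C d h i)) ^ ((-1 : ℤ) ^ (i + 1))

open scoped Classical in
/-- The Reidemeister torsion `τ(C_*, e)`: it is `τ̂(C_*, e, 1)` if the complex is acyclic, and
`0` otherwise. -/
def torsion (n : ℕ) {ι : ℕ → Type} [∀ i, Fintype (ι i)] (e : ∀ i, Basis (ι i) F (C i)) : F :=
  if ∀ i, bdry F C d i = cyc F C d i then
    torsionHat F C d n e fun i => Module.finBasis F (hml F C d i)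
  else 0

variable {ι : ℕ → Type} [∀ i, Fintype (ι i)] (e : ∀ i, Basis (ι i) F (C i))
  (S T : ∀ i, Finset (ι i))

/-- The composition `π_{B_i} ∘ ∂|_{A_{i+1}} : A_{i+1} → B_i`, where `A_i = span(e_i(S_i))` and
`B_i = span(e_i(T_i))` form a direct sum decomposition of `C_i`, and `π_{B_i}` is the projection
onto `B_i` along `A_i`. -/
def projBoundary
    (hcompl : ∀ i, IsCompl (span F (⇑(e i) '' ↑(S i))) (span F (⇑(e i) '' ↑(T i)))) (i : ℕ) :
    ↥(span F (⇑(e (i + 1)) '' ↑(S (i + 1)))) →ₗ[F] ↥(span F (⇑(e i) '' ↑(T i))) :=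
  (Submodule.linearProjOfIsCompl (span F (⇑(e i) '' ↑(T i))) (span F (⇑(e i) '' ↑(S i)))
      (hcompl i).symm).comp
    ((d i).comp (span F (⇑(e (i + 1)) '' ↑(S (i + 1)))).subtype)

end Torsion

section SignedDeterminants

variable {F}

/-- Up to sign, `detFam` may be computed with any identification of the index types. -/
lemma detFam_sq {M ι κ γ : Type} [AddCommGroup M] [Module F M] [Fintype ι] [Fintype κ]
    [Fintype γ] [DecidableEq γ] (e : Basis ι F M) (v : κ → M) (ρ : ι ≃ γ) (σ : κ ≃ γ) :
    detFam F e v ^ 2 = (e.reindex ρ).det (v ∘ σ.symm) ^ 2 := by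
  classical
  have hc : Nonempty (κ ≃ ι) := ⟨σ.trans ρ.symm⟩
  rw [detFam, dif_pos hc, Basis.det_reindex]
  set c := Classical.choice hc
  have hv : (v ∘ σ.symm) ∘ ρ = (v ∘ c.symm) ∘ (ρ.trans (σ.symm.trans c)) := by
    ext x; simp
  rw [hv, AlternatingMap.map_perm, Units.smul_def, zsmul_eq_mul, mul_pow]
  have hs : (((Equiv.Perm.sign (ρ.trans (σ.symm.trans c)) : ℤˣ) : ℤ) : F) ^ 2 = 1 := by
    rcases Int.units_eq_one_or (Equiv.Perm.sign (ρ.trans (σ.symm.trans c))) with h | h <;>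
      simp [h]
  rw [hs, one_mul]

lemma detMap_ne_zero {M N ι κ : Type} [AddCommGroup M] [Module F M] [AddCommGroup N]
    [Module F N] [Fintype κ] [Fintype ι] (bM : Basis κ F M) (bN : Basis ι F N) (f : M →ₗ[F] N)
    (hf : Function.Bijective f) : detMap F bM bN f ≠ 0 := by
  classical
  let b := bM.map (LinearEquiv.ofBijective f hf)
  let σ : κ ≃ ι := b.indexEquiv bN
  have h := detFam_sq bN (fun j => f (bM j)) (Equiv.refl ι) σ
  have hu : IsUnit (bN.det (b.reindex σ)) := bN.isUnit_det _
  have hb : (fun j => f (bM j)) ∘ σ.symm = b.reindex σ := by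
    ext x; simp [b]
  rw [hb, Basis.reindex_refl] at h
  rw [detMap, ← pow_ne_zero_iff two_ne_zero, h]
  exact pow_ne_zero 2 hu.ne_zero

lemma detMap_sq_of_isEmpty {M N ι κ : Type} [AddCommGroup M] [Module F M] [AddCommGroup N]
    [Module F N] [Fintype κ] [Fintype ι] [IsEmpty ι] [IsEmpty κ] (bM : Basis κ F M)
    (bN : Basis ι F N) (f : M →ₗ[F] N) : detMap F bM bN f ^ 2 = 1 := by
  classical
  rw [detMap, detFam_sq bN _ (Equiv.refl ι) (Equiv.equivOfIsEmpty κ ι)]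
  simp

/-- Multiplicativity of determinants for a family `v` and a basis `e` that are block triangular
with respect to the pair of maps `(ψ, φ)`. -/
lemma det_mul_det_of_block {M N₁ N₂ α β : Type} [AddCommGroup M] [Module F M]
    [AddCommGroup N₁] [Module F N₁] [AddCommGroup N₂] [Module F N₂]
    [Fintype α] [Fintype β] [DecidableEq α] [DecidableEq β]
    (e : Basis (α ⊕ β) F M) (f₁ : Basis α F N₁) (f₂ : Basis β F N₂)
    (ψ : M →ₗ[F] N₁) (φ : M →ₗ[F] N₂) (v : α ⊕ β → M)
    (hψl : ∀ a, ψ (e (Sum.inl a)) = f₁ a) (hψr : ∀ b, ψ (e (Sum.inr b)) = 0)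
    (hv : ∀ a, φ (v (Sum.inl a)) = 0) :
    e.det v * f₂.det (fun b => φ (e (Sum.inr b))) =
      f₁.det (fun a => ψ (v (Sum.inl a))) * f₂.det (fun b => φ (v (Sum.inr b))) := by
  let f := f₁.prod f₂
  let g := ψ.prod φ
  have hmul : LinearMap.toMatrix e f g * e.toMatrix v = f.toMatrix (g ∘ v) := by
    ext i j
    have h := congrFun (LinearMap.toMatrix_mulVec_repr e f g (v j)) i
    simpa [Matrix.mul_apply, Matrix.mulVec, dotProduct, Basis.toMatrix_apply] using h
  have hG : LinearMap.toMatrix e f g =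
      Matrix.fromBlocks 1 0 (Matrix.of fun b a => f₂.repr (φ (e (Sum.inl a))) b)
        (f₂.toMatrix fun b => φ (e (Sum.inr b))) := by
    ext i j
    rcases i with i | i <;> rcases j with j | j <;>
      simp [f, g, LinearMap.toMatrix_apply, hψl, hψr, Basis.toMatrix_apply, Matrix.one_apply,
        Finsupp.single_apply, eq_comm]
  have hV : f.toMatrix (g ∘ v) =
      Matrix.fromBlocks (f₁.toMatrix fun a => ψ (v (Sum.inl a)))
        (Matrix.of fun a b => f₁.repr (ψ (v (Sum.inr b))) a) 0
        (f₂.toMatrix fun b => φ (v (Sum.inr b))) := by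
    ext i j
    rcases i with i | i <;> rcases j with j | j <;>
      simp [f, g, hv, Basis.toMatrix_apply]
  have hdet := congrArg Matrix.det hmul
  rw [Matrix.det_mul, hG, hV, Matrix.det_fromBlocks_zero₁₂, Matrix.det_fromBlocks_zero₂₁,
    Matrix.det_one, one_mul] at hdet
  simp only [Basis.det_apply]
  rw [mul_comm, hdet]

/-- The version of `det_mul_det_of_block` for `detFam`, with arbitrary index types. -/
lemma detFam_sq_mul_sq_of_block {M N₁ N₂ ι S α β κ κ₁ κ₂ : Type} [AddCommGroup M] [Module F M]
    [AddCommGroup N₁] [Module F N₁] [AddCommGroup N₂] [Module F N₂]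
    [Fintype ι] [Fintype S] [Fintype α] [Fintype β] [Fintype κ] [Fintype κ₁] [Fintype κ₂]
    (e : Basis ι F M) (f₁ : Basis α F N₁) (f₂ : Basis β F N₂)
    (ψ : M →ₗ[F] N₁) (φ : M →ₗ[F] N₂) (v : κ → M)
    (ρ : α ⊕ S ≃ ι) (s : S ≃ β) (τ : κ₁ ⊕ κ₂ ≃ κ) (t₁ : κ₁ ≃ α) (t₂ : κ₂ ≃ β)
    (hψl : ∀ a, ψ (e (ρ (Sum.inl a))) = f₁ a) (hψr : ∀ b, ψ (e (ρ (Sum.inr b))) = 0)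
    (hv : ∀ a, φ (v (τ (Sum.inl a))) = 0) :
    detFam F e v ^ 2 * detFam F f₂ (fun b => φ (e (ρ (Sum.inr b)))) ^ 2 =
      detFam F f₁ (fun a => ψ (v (τ (Sum.inl a)))) ^ 2 *
        detFam F f₂ (fun b => φ (v (τ (Sum.inr b)))) ^ 2 := by
  classical
  rw [detFam_sq e v (ρ.symm.trans ((Equiv.refl α).sumCongr s)) (τ.symm.trans (t₁.sumCongr t₂)),
    detFam_sq f₂ (fun b => φ (e (ρ (Sum.inr b)))) (Equiv.refl β) s,
    detFam_sq f₁ _ (Equiv.refl α) t₁,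
    detFam_sq f₂ (fun b => φ (v (τ (Sum.inr b)))) (Equiv.refl β) t₂, ← mul_pow, ← mul_pow]
  congr 1
  have h := det_mul_det_of_block
    (e.reindex (ρ.symm.trans ((Equiv.refl α).sumCongr s))) f₁ f₂ ψ φ
    (v ∘ (τ.symm.trans (t₁.sumCongr t₂)).symm)
    (by intro a; simpa using hψl a) (by intro b; simpa using hψr (s.symm b))
    (by intro a; simpa using hv (t₁.symm a))
  simpa [Function.comp_def] using h

end SignedDeterminants

section SubBasis

variable {F}

@[simp]
lemma coe_subBasis {M ι : Type} [AddCommGroup M] [Module F M] (e : Basis ι F M) (S : Finset ι)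
    (j : {j // j ∈ S}) : (subBasis F e S j : M) = e j := by
  simp [subBasis, Basis.span_apply]

/-- If the spans of two subsets of a basis are complementary, then the subsets partition the
index type. -/
lemma bijective_sumElim_of_isCompl_span {M ι : Type} [AddCommGroup M] [Module F M]
    (e : Basis ι F M) (S T : Finset ι)
    (h : IsCompl (span F (⇑e '' ↑S)) (span F (⇑e '' ↑T))) :
    Function.Bijective
      (Sum.elim Subtype.val Subtype.val : {j // j ∈ T} ⊕ {j // j ∈ S} → ι) := by
  have hdis : ∀ j ∈ S, j ∉ T := fun j hS hT => e.ne_zero j <|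
    Submodule.disjoint_def.mp h.disjoint (e j)
      (subset_span ⟨j, hS, rfl⟩) (subset_span ⟨j, hT, rfl⟩)
  constructor
  · refine Function.Injective.sumElim Subtype.val_injective Subtype.val_injective ?_
    rintro ⟨a, ha⟩ ⟨b, hb⟩ (rfl : a = b)
    exact hdis a hb ha
  · intro j
    have hj : e j ∈ span F (⇑e '' (↑S ∪ ↑T)) := by
      rw [Set.image_union, span_union, h.sup_eq_top]
      trivial
    rw [Basis.mem_span_image, Basis.repr_self, Finsupp.support_single _ one_ne_zero] at hj
    rcases hj (by simp : j ∈ _) with hj | hj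
    · exact ⟨Sum.inr ⟨j, hj⟩, rfl⟩
    · exact ⟨Sum.inl ⟨j, hj⟩, rfl⟩

lemma eq_empty_of_span_image_eq_bot {M J : Type} [AddCommGroup M] [Module F M] (b : Basis J F M)
    (A : Finset J) (h : span F (⇑b '' ↑A) = ⊥) : A = ∅ := by
  refine Finset.eq_empty_of_forall_notMem fun j hj => b.ne_zero j ?_
  exact (Submodule.mem_bot F).mp (h ▸ subset_span ⟨j, hj, rfl⟩)

end SubBasis

section Acyclic

variable {F} {C : ℕ → Type} [∀ i, AddCommGroup (C i)] [∀ i, Module F (C i)]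
  {d : ∀ i, C (i + 1) →ₗ[F] C i}

lemma finrank_hml_eq_zero (hacyc : ∀ i, bdry F C d i = cyc F C d i) (i : ℕ) :
    finrank F (hml F C d i) = 0 := by
  have h : Submodule.comap (cyc F C d i).subtype (bdry F C d i) = ⊤ := by
    rw [hacyc]; exact Submodule.comap_subtype_self _
  have : Subsingleton (hml F C d i) := Submodule.Quotient.subsingleton_iff.mpr h
  exact finrank_zero_of_subsingleton

variable {ι : ℕ → Type} {e : ∀ i, Basis (ι i) F (C i)}
  {S T : ∀ i, Finset (ι i)}

/-- The projection of the boundaries in degree `i` onto the span of `e_i(T_i)` along the span of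
`e_i(S_i)`. -/
def bdryProj
    (hcompl : ∀ i, IsCompl (span F (⇑(e i) '' ↑(S i))) (span F (⇑(e i) '' ↑(T i)))) (i : ℕ) :
    bdry F C d i →ₗ[F] ↥(span F (⇑(e i) '' ↑(T i))) :=
  (Submodule.projectionOnto _ _ (hcompl i).symm).comp (bdry F C d i).subtype

lemma card_eq_of_bijective_projBoundary
    {hcompl : ∀ i, IsCompl (span F (⇑(e i) '' ↑(S i))) (span F (⇑(e i) '' ↑(T i)))}
    (hbij : ∀ i, Function.Bijective (projBoundary F C d e S T hcompl i)) (i : ℕ) :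
    (S (i + 1)).card = (T i).card := by
  have h := (LinearEquiv.ofBijective _ (hbij i)).finrank_eq
  rwa [finrank_eq_card_basis (subBasis F (e (i + 1)) (S (i + 1))),
    finrank_eq_card_basis (subBasis F (e i) (T i)), Fintype.card_coe, Fintype.card_coe] at h

variable [∀ i, Fintype (ι i)]

lemma finrank_eq_card_add_card
    (hcompl : ∀ i, IsCompl (span F (⇑(e i) '' ↑(S i))) (span F (⇑(e i) '' ↑(T i)))) (i : ℕ) :
    finrank F (C i) = (T i).card + (S i).card := by
  have h := Fintype.card_congr
    (Equiv.ofBijective _ (bijective_sumElim_of_isCompl_span (e i) (S i) (T i) (hcompl i)))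
  rw [finrank_eq_card_basis (e i), ← h, Fintype.card_sum, Fintype.card_coe, Fintype.card_coe]

variable [∀ i, FiniteDimensional F (C i)]

lemma d_secB (i : ℕ) (x : bdry F C d i) : d i (secB F C d i x) = x :=
  congrArg Subtype.val (LinearMap.congr_fun
    ((d i).rangeRestrict.exists_rightInverse_of_surjective
      (LinearMap.range_eq_top.mpr (d i).surjective_rangeRestrict)).choose_spec x)

lemma finrank_bdry (hacyc : ∀ i, bdry F C d i = cyc F C d i)
    {hcompl : ∀ i, IsCompl (span F (⇑(e i) '' ↑(S i))) (span F (⇑(e i) '' ↑(T i)))}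
    (hS0 : span F (⇑(e 0) '' ↑(S 0)) = ⊥)
    (hbij : ∀ i, Function.Bijective (projBoundary F C d e S T hcompl i)) (i : ℕ) :
    finrank F (bdry F C d i) = (T i).card := by
  induction i with
  | zero =>
    rw [hacyc, show cyc F C d 0 = ⊤ from rfl, finrank_top, finrank_eq_card_add_card hcompl,
      eq_empty_of_span_image_eq_bot _ _ hS0, Finset.card_empty, add_zero]
  | succ i ih =>
    have h := (d i).finrank_range_add_finrank_ker
    rw [finrank_eq_card_add_card hcompl, card_eq_of_bijective_projBoundary hbij, ← ih,
      add_comm] at h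
    rw [hacyc]
    exact Nat.add_right_cancel h

lemma bijective_bdryProj (hacyc : ∀ i, bdry F C d i = cyc F C d i)
    {hcompl : ∀ i, IsCompl (span F (⇑(e i) '' ↑(S i))) (span F (⇑(e i) '' ↑(T i)))}
    (hS0 : span F (⇑(e 0) '' ↑(S 0)) = ⊥)
    (hbij : ∀ i, Function.Bijective (projBoundary F C d e S T hcompl i)) (i : ℕ) :
    Function.Bijective (bdryProj (d := d) hcompl i) := by
  have hsurj : Function.Surjective (bdryProj (d := d) hcompl i) := fun y => by
    obtain ⟨x, hx⟩ := (hbij i).2 y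
    exact ⟨⟨d i x, LinearMap.mem_range_self _ _⟩, hx⟩
  refine ⟨(LinearMap.injective_iff_surjective_of_finrank_eq_finrank ?_).mpr hsurj, hsurj⟩
  rw [finrank_bdry hacyc hS0 hbij, finrank_eq_card_basis (subBasis F (e i) (T i)),
    Fintype.card_coe]

/-- The determinant of the projected boundaries with respect to the chosen basis of the
boundaries. -/
def bdryDet
    (hcompl : ∀ i, IsCompl (span F (⇑(e i) '' ↑(S i))) (span F (⇑(e i) '' ↑(T i)))) (i : ℕ) : F :=
  detMap F (Module.finBasis F (bdry F C d i)) (subBasis F (e i) (T i))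
    (bdryProj (d := d) hcompl i)

lemma detFam_torFam_zero_sq (hacyc : ∀ i, bdry F C d i = cyc F C d i)
    {hcompl : ∀ i, IsCompl (span F (⇑(e i) '' ↑(S i))) (span F (⇑(e i) '' ↑(T i)))}
    (hS0 : span F (⇑(e 0) '' ↑(S 0)) = ⊥)
    (hbij : ∀ i, Function.Bijective (projBoundary F C d e S T hcompl i)) :
    detFam F (e 0) (torFam F C d (fun i => Module.finBasis F (hml F C d i)) 0) ^ 2 =
      bdryDet (d := d) hcompl 0 ^ 2 := by
  have hS := eq_empty_of_span_image_eq_bot _ _ hS0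
  have : IsEmpty {j // j ∈ S 0} := by rw [hS]; infer_instance
  have : IsEmpty (Fin (finrank F (hml F C d 0))) := by
    rw [finrank_hml_eq_zero hacyc]; infer_instance
  let f₂ : Basis (Fin 0) F (Fin 0 → F) := Pi.basisFun F (Fin 0)
  have h := detFam_sq_mul_sq_of_block (e 0) (subBasis F (e 0) (T 0)) f₂
    (Submodule.projectionOnto _ _ (hcompl 0).symm) 0
    (torFam F C d (fun i => Module.finBasis F (hml F C d i)) 0)
    (Equiv.ofBijective _ (bijective_sumElim_of_isCompl_span (e 0) (S 0) (T 0) (hcompl 0)))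
    (Equiv.equivOfIsEmpty _ _)
    ((Equiv.refl _).sumCongr (Equiv.emptySum _ _).symm)
    (Fintype.equivOfCardEq (by simp [finrank_bdry hacyc hS0 hbij]))
    (Equiv.refl (Fin 0))
    (fun a => by
      rw [← Submodule.projectionOnto_apply_left (hcompl 0).symm (subBasis F (e 0) (T 0) a),
        coe_subBasis]
      rfl)
    (fun b => isEmptyElim b) (fun _ => rfl)
  have hone : ∀ {κ : Type} [Fintype κ] [IsEmpty κ] (v : κ → Fin 0 → F),
      detFam F f₂ v ^ 2 = 1 := fun {κ} _ _ v => by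
    rw [detFam_sq f₂ v (Equiv.refl _) (Equiv.equivOfIsEmpty _ _)]
    simp
  have : IsEmpty (Fin (prevRank F C d 0)) := inferInstanceAs (IsEmpty (Fin 0))
  rw [hone, hone, mul_one, mul_one] at h
  exact h

lemma detFam_torFam_succ_sq (hd : ∀ i, (d i).comp (d (i + 1)) = 0)
    (hacyc : ∀ i, bdry F C d i = cyc F C d i)
    {hcompl : ∀ i, IsCompl (span F (⇑(e i) '' ↑(S i))) (span F (⇑(e i) '' ↑(T i)))}
    (hS0 : span F (⇑(e 0) '' ↑(S 0)) = ⊥)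
    (hbij : ∀ i, Function.Bijective (projBoundary F C d e S T hcompl i)) (i : ℕ) :
    detFam F (e (i + 1)) (torFam F C d (fun i => Module.finBasis F (hml F C d i)) (i + 1)) ^ 2 *
        detMap F (subBasis F (e (i + 1)) (S (i + 1))) (subBasis F (e i) (T i))
          (projBoundary F C d e S T hcompl i) ^ 2 =
      bdryDet (d := d) hcompl (i + 1) ^ 2 * bdryDet (d := d) hcompl i ^ 2 := by
  have : IsEmpty (Fin (finrank F (hml F C d (i + 1)))) := by
    rw [finrank_hml_eq_zero hacyc]; infer_instance
  have h := detFam_sq_mul_sq_of_block (e (i + 1)) (subBasis F (e (i + 1)) (T (i + 1)))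
    (subBasis F (e i) (T i))
    (Submodule.projectionOnto _ _ (hcompl (i + 1)).symm)
    ((Submodule.projectionOnto _ _ (hcompl i).symm).comp (d i))
    (torFam F C d (fun i => Module.finBasis F (hml F C d i)) (i + 1))
    (Equiv.ofBijective _
      (bijective_sumElim_of_isCompl_span (e (i + 1)) (S (i + 1)) (T (i + 1)) (hcompl (i + 1))))
    (Fintype.equivOfCardEq (by simp [card_eq_of_bijective_projBoundary hbij]))
    ((Equiv.refl _).sumCongr (Equiv.emptySum _ _).symm)
    (Fintype.equivOfCardEq (by simp [finrank_bdry hacyc hS0 hbij]))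
    (Fintype.equivOfCardEq (by simp [prevRank, finrank_bdry hacyc hS0 hbij]))
    (fun a => by
      rw [← Submodule.projectionOnto_apply_left (hcompl (i + 1)).symm
        (subBasis F (e (i + 1)) (T (i + 1)) a), coe_subBasis]
      rfl)
    (fun b => Submodule.projectionOnto_apply_right (hcompl (i + 1)).symm
      ⟨_, subset_span ⟨b, b.2, rfl⟩⟩)
    (fun a => by
      obtain ⟨x, hx⟩ := (Module.finBasis F (bdry F C d (i + 1)) a).2
      have hx0 : d i (d (i + 1) x) = 0 := LinearMap.congr_fun (hd i) x
      rw [hx] at hx0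
      exact (congrArg (Submodule.projectionOnto _ _ (hcompl i).symm) hx0).trans (map_zero _))
  have hM : (fun b : {j // j ∈ S (i + 1)} =>
      projBoundary F C d e S T hcompl i (subBasis F (e (i + 1)) (S (i + 1)) b)) =
      fun b : {j // j ∈ S (i + 1)} =>
        Submodule.projectionOnto _ _ (hcompl i).symm (d i (e (i + 1) b)) := by
    funext b
    rw [← coe_subBasis (e (i + 1)) (S (i + 1)) b]
    rfl
  have hB : (fun j => bdryProj (d := d) hcompl i (Module.finBasis F (bdry F C d i) j)) =
      fun j => Submodule.projectionOnto _ _ (hcompl i).symm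
        (d i (secB F C d i (Module.finBasis F (bdry F C d i) j))) := by
    ext j
    rw [d_secB]
    rfl
  rw [detMap, hM, bdryDet, bdryDet, detMap, detMap, hB]
  exact h

end Acyclic

/-- A telescoping alternating product. -/
lemma prod_zpow_telescope {K : Type} [Field K] (D b m : ℕ → K) (hb : ∀ i, b i ≠ 0)
    (hm : ∀ i, m i ≠ 0) (h0 : D 0 = b 0) (hD : ∀ i, D (i + 1) * m i = b (i + 1) * b i) (n : ℕ) :
    ∏ i ∈ Finset.range (n + 1), D i ^ ((-1 : ℤ) ^ (i + 1)) =
      (∏ i ∈ Finset.range n, m i ^ ((-1 : ℤ) ^ (i + 1))) * b n ^ ((-1 : ℤ) ^ (n + 1)) := by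
  induction n with
  | zero => simp [h0]
  | succ n ih =>
    rw [Finset.prod_range_succ, ih, Finset.prod_range_succ,
      eq_div_of_mul_eq (hm n) (hD n), div_zpow, mul_zpow, pow_succ (-1 : ℤ) (n + 1)]
    have h1 := zpow_ne_zero ((-1 : ℤ) ^ (n + 1)) (hb n)
    have h2 := zpow_ne_zero ((-1 : ℤ) ^ (n + 1)) (hm n)
    simp only [mul_neg_one, zpow_neg]
    field_simp

/-- Let `F` be a field and `(C_*, ∂)` a finite acyclic chain complex of finite-dimensional
`F`-vector spaces, concentrated in degrees `0, …, n`, with ordered basis `e`.  Suppose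
`C_i = A_i ⊕ B_i` is a decomposition with `A_i = span(e_i(S_i))` and `B_i = span(e_i(T_i))`
spanned by subsets of the basis `e_i`, such that `π_{B_{i-1}} ∘ ∂|_{A_i} : A_i → B_{i-1}` is an
isomorphism for every `i` (for `i = 0` this means `A_0 = B_{-1} = 0`).  Then the Reidemeister
torsion satisfies `τ(C_*, e) = ± Π_i det(π_{B_{i-1}} ∘ ∂|_{A_i})^{(-1)^i}`, where each
determinant is computed with respect to the chosen subbases of `e`. -/
theorem torsion_eq_alternating_prod_det
    (C : ℕ → Type) [∀ i, AddCommGroup (C i)] [∀ i, Module F (C i)]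
    [∀ i, FiniteDimensional F (C i)]
    (d : ∀ i, C (i + 1) →ₗ[F] C i)
    (hd : ∀ i, (d i).comp (d (i + 1)) = 0)
    (n : ℕ) (htriv : ∀ i, n < i → Subsingleton (C i))
    (ι : ℕ → Type) [∀ i, Fintype (ι i)] (e : ∀ i, Basis (ι i) F (C i))
    (hacyc : ∀ i, bdry F C d i = cyc F C d i)
    (S T : ∀ i, Finset (ι i))
    (hcompl : ∀ i, IsCompl (span F (⇑(e i) '' ↑(S i))) (span F (⇑(e i) '' ↑(T i))))
    (hS0 : span F (⇑(e 0) '' ↑(S 0)) = ⊥)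
    (hbij : ∀ i, Function.Bijective (projBoundary F C d e S T hcompl i)) :
    torsion F C d n e =
        ∏ i ∈ Finset.range (n + 1),
          (detMap F (subBasis F (e (i + 1)) (S (i + 1))) (subBasis F (e i) (T i))
              (projBoundary F C d e S T hcompl i)) ^ ((-1 : ℤ) ^ (i + 1)) ∨
      torsion F C d n e =
        -∏ i ∈ Finset.range (n + 1),
          (detMap F (subBasis F (e (i + 1)) (S (i + 1))) (subBasis F (e i) (T i))
              (projBoundary F C d e S T hcompl i)) ^ ((-1 : ℤ) ^ (i + 1)) := by
  rw [← sq_eq_sq_iff_eq_or_eq_neg, _root_.torsion, if_pos hacyc, torsionHat]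
  have hsq (x : ℕ → F) : (∏ i ∈ Finset.range (n + 1), x i ^ ((-1 : ℤ) ^ (i + 1))) ^ 2 =
      ∏ i ∈ Finset.range (n + 1), (x i ^ 2) ^ ((-1 : ℤ) ^ (i + 1)) := by
    rw [← Finset.prod_pow]
    refine Finset.prod_congr rfl fun i _ => ?_
    rw [← zpow_natCast, ← zpow_natCast, zpow_comm]
  rw [hsq, hsq]
  have hb i : bdryDet (d := d) hcompl i ^ 2 ≠ 0 :=
    pow_ne_zero 2 (detMap_ne_zero _ _ _ (bijective_bdryProj hacyc hS0 hbij i))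
  have hm i : detMap F (subBasis F (e (i + 1)) (S (i + 1))) (subBasis F (e i) (T i))
      (projBoundary F C d e S T hcompl i) ^ 2 ≠ 0 :=
    pow_ne_zero 2 (detMap_ne_zero _ _ _ (hbij i))
  rw [prod_zpow_telescope _ _ _ hb hm (detFam_torFam_zero_sq hacyc hS0 hbij)
    (detFam_torFam_succ_sq hd hacyc hS0 hbij), Finset.prod_range_succ]
  have : Subsingleton (C (n + 1)) := htriv (n + 1) n.lt_succ_self
  have hS : S (n + 1) = ∅ := eq_empty_of_span_image_eq_bot (e (n + 1)) _ (Subsingleton.elim _ _)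
  have hT : (T n).card = 0 := by
    rw [← card_eq_of_bijective_projBoundary hbij, hS, Finset.card_empty]
  have : IsEmpty {j // j ∈ S (n + 1)} := by rw [hS]; infer_instance
  have : IsEmpty {j // j ∈ T n} := by rw [Finset.card_eq_zero.mp hT]; infer_instance
  have : IsEmpty (Fin (finrank F (bdry F C d n))) := by
    rw [finrank_bdry hacyc hS0 hbij, hT]; infer_instance
  rw [bdryDet, detMap_sq_of_isEmpty, detMap_sq_of_isEmpty]

end
end
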